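/- If Δ₁ ∈ ℝ^{(n−ν)×(n−ν)} is a symmetric solution of the reduced equation CGDARE(Σ₁), then X = U · [[Δ₁ + Q₁₁, Q₁₂], [Q₁₂ᵀ, Q₂₂]] · Uᵀ is a symmetric solution of CGDARE(Σ). -/

import Mathlib

open Matrix

/-- `Md` satisfies the four Penrose equations for `M`, i.e. it is the
Moore–Penrose pseudoinverse `M†` of `M`. -/
def IsMP {p q : ℕ} (M : Matrix (Fin p) (Fin q) ℝ) (Md : Matrix (Fin q) (Fin p) ℝ) : Prop :=
  M * Md * M = M ∧ Md * M * Md = Md ∧ (M * Md)ᵀ = M * Md ∧ (Md * M)ᵀ = Md * M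

theorem IsMP.unique {p q : ℕ} {M : Matrix (Fin p) (Fin q) ℝ} {N P : Matrix (Fin q) (Fin p) ℝ}
    (hN : IsMP M N) (hP : IsMP M P) : N = P := by
  obtain ⟨n1, n2, n3, n4⟩ := hN
  obtain ⟨p1, p2, p3, p4⟩ := hP
  have hMN : M * N = M * P := by
    calc M * N = (M * P) * (M * N) := by rw [← Matrix.mul_assoc, p1]
      _ = ((M * N) * (M * P))ᵀ := by rw [transpose_mul, n3, p3]
      _ = M * P := by rw [← Matrix.mul_assoc, n1, p3]
  have hNM : N * M = P * M := by
    calc N * M = (N * M) * (P * M) := by rw [Matrix.mul_assoc, ← Matrix.mul_assoc M, p1]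
      _ = ((P * M) * (N * M))ᵀ := by rw [transpose_mul, n4, p4]
      _ = P * M := by rw [Matrix.mul_assoc, ← Matrix.mul_assoc M, n1, p4]
  rw [← n2, hNM, Matrix.mul_assoc, hMN, ← Matrix.mul_assoc, p2]

theorem IsMP.transpose {p q : ℕ} {M : Matrix (Fin p) (Fin q) ℝ} {N : Matrix (Fin q) (Fin p) ℝ}
    (h : IsMP M N) : IsMP Mᵀ Nᵀ := by
  obtain ⟨h1, h2, h3, h4⟩ := h
  refine ⟨?_, ?_, ?_, ?_⟩
  · rw [← transpose_mul, ← transpose_mul, ← Matrix.mul_assoc, h1]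
  · rw [← transpose_mul, ← transpose_mul, ← Matrix.mul_assoc, h2]
  · rw [← transpose_mul, h4, h4]
  · rw [← transpose_mul, h3, h3]

theorem IsMP.transpose_eq_self {p : ℕ} {M N : Matrix (Fin p) (Fin p) ℝ}
    (h : IsMP M N) (hM : Mᵀ = M) : Nᵀ = N :=
  IsMP.unique (M := M) (by simpa only [hM] using h.transpose) h

theorem IsMP.mul_mul_eq_of_ker_le {p q r : ℕ} {M : Matrix (Fin p) (Fin q) ℝ}
    {Md : Matrix (Fin q) (Fin p) ℝ} (h : IsMP M Md) {N : Matrix (Fin r) (Fin q) ℝ}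
    (hker : LinearMap.ker M.mulVecLin ≤ LinearMap.ker N.mulVecLin) : N * Md * M = N := by
  have hz : N * (1 - Md * M) = 0 := by
    refine Matrix.ext_of_mulVec_single fun i => ?_
    rw [← mulVec_mulVec, zero_mulVec]
    have hmem : (1 - Md * M) *ᵥ Pi.single i 1 ∈ LinearMap.ker M.mulVecLin := by
      rw [LinearMap.mem_ker, mulVecLin_apply, mulVec_mulVec, Matrix.mul_sub, Matrix.mul_one,
        ← Matrix.mul_assoc, h.1, sub_self, zero_mulVec]
    simpa using hker hmem
  rw [Matrix.mul_sub, Matrix.mul_one, sub_eq_zero] at hz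
  rw [Matrix.mul_assoc, ← hz]

theorem ker_le_ker_of_posSemidef_fromBlocks {p q : ℕ} {Q : Matrix (Fin p) (Fin p) ℝ}
    {S : Matrix (Fin p) (Fin q) ℝ} {R : Matrix (Fin q) (Fin q) ℝ}
    (h : (fromBlocks Q S Sᵀ R).PosSemidef) :
    LinearMap.ker R.mulVecLin ≤ LinearMap.ker S.mulVecLin := by
  intro v hv
  rw [LinearMap.mem_ker, mulVecLin_apply] at hv ⊢
  have hmul : fromBlocks Q S Sᵀ R *ᵥ Sum.elim 0 v = Sum.elim (S *ᵥ v) 0 := by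
    simp [fromBlocks_mulVec, hv]
  have h0 : fromBlocks Q S Sᵀ R *ᵥ Sum.elim 0 v = 0 := by
    rw [← h.dotProduct_mulVec_zero_iff, hmul]
    simp [dotProduct]
  funext i
  simpa [hmul] using congrFun h0 (Sum.inl i)

/-- The feedback change `A ↦ A - B F` with `S = Fᵀ R` preserves solutions of the Riccati
equation. -/
theorem riccati_of_feedback {n m : ℕ} {A A0 Q X : Matrix (Fin n) (Fin n) ℝ}
    {B S : Matrix (Fin n) (Fin m) ℝ} {R RX RXd : Matrix (Fin m) (Fin m) ℝ}
    {F : Matrix (Fin m) (Fin n) ℝ} (hA : A = A0 + B * F) (hS : Fᵀ * R = S)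
    (hR : Rᵀ = R) (hX : Xᵀ = X) (hRX : RX = R + Bᵀ * X * B) (hRXd : IsMP RX RXd)
    (hker : LinearMap.ker RX.mulVecLin ≤ LinearMap.ker (A0ᵀ * X * B).mulVecLin)
    (heq : X = A0ᵀ * X * A0 - (A0ᵀ * X * B) * RXd * (A0ᵀ * X * B)ᵀ + (Q - S * F)) :
    X = Aᵀ * X * A - (Aᵀ * X * B + S) * RXd * (Aᵀ * X * B + S)ᵀ + Q ∧
      LinearMap.ker RX.mulVecLin ≤ LinearMap.ker (Aᵀ * X * B + S).mulVecLin := by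
  have hRXs : RXᵀ = RX := by
    rw [hRX]
    simp only [transpose_add, transpose_mul, transpose_transpose, hR, hX, Matrix.mul_assoc]
  have hRXds : RXdᵀ = RXd := hRXd.transpose_eq_self hRXs
  set G := A0ᵀ * X * B with hG
  have hSX : Aᵀ * X * B + S = G + Fᵀ * RX := by
    rw [hG, hRX, ← hS, hA]
    simp only [transpose_add, transpose_mul, Matrix.add_mul, Matrix.mul_add, Matrix.mul_assoc]
    abel
  have hGR : G * RXd * RX = G := hRXd.mul_mul_eq_of_ker_le hker
  have hRG : RX * RXd * Gᵀ = Gᵀ := by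
    have := congrArg Matrix.transpose hGR
    simpa only [transpose_mul, hRXs, hRXds, Matrix.mul_assoc] using this
  refine ⟨?_, ?_⟩
  · have hGt : Gᵀ = Bᵀ * X * A0 := by
      rw [hG]
      simp only [transpose_mul, transpose_transpose, hX, Matrix.mul_assoc]
    have hquad : (Aᵀ * X * B + S) * RXd * (Aᵀ * X * B + S)ᵀ =
        G * RXd * Gᵀ + G * F + Fᵀ * Gᵀ + Fᵀ * RX * F := by
      calc (Aᵀ * X * B + S) * RXd * (Aᵀ * X * B + S)ᵀ
          = G * RXd * Gᵀ + (G * RXd * RX) * F + Fᵀ * (RX * RXd * Gᵀ)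
            + Fᵀ * (RX * RXd * RX) * F := by
            rw [hSX]
            simp only [transpose_add, transpose_mul, transpose_transpose, hRXs,
              Matrix.add_mul, Matrix.mul_add, Matrix.mul_assoc]
            abel
        _ = _ := by rw [hGR, hRG, hRXd.1]
    have hAXA : Aᵀ * X * A = A0ᵀ * X * A0 + G * F + Fᵀ * Gᵀ + Fᵀ * RX * F - S * F := by
      rw [hGt, hG, hRX, ← hS, hA]
      simp only [transpose_add, transpose_mul, Matrix.add_mul, Matrix.mul_add, Matrix.mul_assoc]
      abel
    rw [hquad, hAXA]
    refine heq.trans ?_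
    abel
  · intro v hv
    have hGv := hker hv
    rw [LinearMap.mem_ker, mulVecLin_apply] at hv hGv ⊢
    rw [hSX, add_mulVec, hGv, ← mulVec_mulVec, hv, mulVec_zero, add_zero]

/-- If `Δ₁` is a symmetric solution of the reduced equation
CGDARE(Σ₁), then `X = U [[Δ₁ + Q₁₁, Q₁₂], [Q₁₂ᵀ, Q₂₂]] Uᵀ` is a symmetric solution
of CGDARE(Σ). -/
theorem stmt12 {n m ν : ℕ} (hn : 0 < n) (hm : 0 < m)
    (A : Matrix (Fin n) (Fin n) ℝ) (B : Matrix (Fin n) (Fin m) ℝ)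
    (Q : Matrix (Fin n) (Fin n) ℝ) (S : Matrix (Fin n) (Fin m) ℝ)
    (R : Matrix (Fin m) (Fin m) ℝ)
    (hQ : Qᵀ = Q) (hR : Rᵀ = R)
    (hPi : (fromBlocks Q S Sᵀ R).PosSemidef)
    (Rd : Matrix (Fin m) (Fin m) ℝ) (hRd : IsMP R Rd)
    (A0 Q0 : Matrix (Fin n) (Fin n) ℝ)
    (hA0 : A0 = A - B * Rd * Sᵀ) (hQ0 : Q0 = Q - S * Rd * Sᵀ)
    (hnu : ν = Module.finrank ℝ (LinearMap.ker A0.mulVecLin))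
    (U : Matrix (Fin n) (Fin (n - ν) ⊕ Fin ν) ℝ)
    (hUl : Uᵀ * U = 1) (hUr : U * Uᵀ = 1)
    (hUspan : LinearMap.range (U.submatrix id Sum.inr).mulVecLin =
      LinearMap.ker A0.mulVecLin)
    (Atil : Matrix (Fin (n - ν) ⊕ Fin ν) (Fin (n - ν)) ℝ)
    (hAtil : Atil = Uᵀ * A0 * U.submatrix id Sum.inl)
    (BU : Matrix (Fin (n - ν) ⊕ Fin ν) (Fin m) ℝ) (hBU : BU = Uᵀ * B)
    (QU : Matrix (Fin (n - ν) ⊕ Fin ν) (Fin (n - ν) ⊕ Fin ν) ℝ) (hQU : QU = Uᵀ * Q0 * U)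
    (Q1 : Matrix (Fin (n - ν)) (Fin (n - ν)) ℝ) (hQ1 : Q1 = Atilᵀ * QU * Atil)
    (S1 : Matrix (Fin (n - ν)) (Fin m) ℝ) (hS1 : S1 = Atilᵀ * QU * BU)
    (R1 : Matrix (Fin m) (Fin m) ℝ) (hR1 : R1 = R + BUᵀ * QU * BU)
    (A1 : Matrix (Fin (n - ν)) (Fin (n - ν)) ℝ) (hA1 : A1 = Atil.submatrix Sum.inl id)
    (B1 : Matrix (Fin (n - ν)) (Fin m) ℝ) (hB1 : B1 = BU.submatrix Sum.inl id)
    (D1 : Matrix (Fin (n - ν)) (Fin (n - ν)) ℝ) (hD1sym : D1ᵀ = D1)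
    (RD1d : Matrix (Fin m) (Fin m) ℝ) (hRD1d : IsMP (R1 + B1ᵀ * D1 * B1) RD1d)
    (heq1 : D1 = A1ᵀ * D1 * A1 - (A1ᵀ * D1 * B1 + S1) * RD1d * (B1ᵀ * D1 * A1 + S1ᵀ) + Q1)
    (hker1 : LinearMap.ker (R1 + B1ᵀ * D1 * B1).mulVecLin ≤
      LinearMap.ker (S1 + A1ᵀ * D1 * B1).mulVecLin)
    (X : Matrix (Fin n) (Fin n) ℝ)
    (hXdef : X = U * fromBlocks (D1 + QU.toBlocks₁₁) QU.toBlocks₁₂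
      (QU.toBlocks₁₂)ᵀ QU.toBlocks₂₂ * Uᵀ)
    (RXd : Matrix (Fin m) (Fin m) ℝ) (hRXd : IsMP (R + Bᵀ * X * B) RXd) :
    Xᵀ = X ∧
    X = Aᵀ * X * A - (Aᵀ * X * B + S) * RXd * (Aᵀ * X * B + S)ᵀ + Q ∧
    LinearMap.ker (R + Bᵀ * X * B).mulVecLin ≤
      LinearMap.ker (Aᵀ * X * B + S).mulVecLin := by
  obtain ⟨V, hV⟩ : ∃ V, V = U.submatrix id Sum.inl := ⟨_, rfl⟩
  obtain ⟨W, hW⟩ : ∃ W, W = U.submatrix id Sum.inr := ⟨_, rfl⟩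
  have hU : U = fromCols V W := by
    rw [hV, hW]
    ext i (j | j) <;> rfl
  have hVW : V * Vᵀ + W * Wᵀ = 1 := by
    rw [← hUr, hU, transpose_fromCols, fromCols_mul_fromRows]
  have hA0W : A0 * W = 0 := by
    refine Matrix.ext_of_mulVec_single fun i => ?_
    rw [← mulVec_mulVec, zero_mulVec, hW]
    have hmem : U.submatrix id Sum.inr *ᵥ Pi.single i 1 ∈ LinearMap.ker A0.mulVecLin :=
      hUspan ▸ LinearMap.mem_range_self (U.submatrix id Sum.inr).mulVecLin (Pi.single i 1)
    simpa using hmem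
  have hA0V : A0 * V * Vᵀ = A0 := by
    calc A0 * V * Vᵀ = A0 * (V * Vᵀ + W * Wᵀ) := by
          rw [Matrix.mul_add, ← Matrix.mul_assoc, ← Matrix.mul_assoc, hA0W, Matrix.zero_mul,
            add_zero]
      _ = A0 := by rw [hVW, Matrix.mul_one]
  have hVA0 : V * (Vᵀ * A0ᵀ) = A0ᵀ := by
    simpa only [transpose_mul, transpose_transpose] using congrArg Matrix.transpose hA0V
  have hRds : Rdᵀ = Rd := hRd.transpose_eq_self hR
  have hSR : S * Rd * R = S :=
    hRd.mul_mul_eq_of_ker_le (ker_le_ker_of_posSemidef_fromBlocks hPi)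
  have hQ0s : Q0ᵀ = Q0 := by
    rw [hQ0]
    simp only [transpose_sub, transpose_mul, transpose_transpose, hQ, hRds, Matrix.mul_assoc]
  have hQUs : QUᵀ = QU := by
    rw [hQU]
    simp only [transpose_mul, transpose_transpose, hQ0s, Matrix.mul_assoc]
  have hX : X = Q0 + V * D1 * Vᵀ := by
    have h21 : QU.toBlocks₁₂ᵀ = QU.toBlocks₂₁ := by
      ext i j
      exact congrFun (congrFun hQUs (Sum.inr i)) (Sum.inl j)
    have hblocks : fromBlocks (D1 + QU.toBlocks₁₁) QU.toBlocks₁₂ (QU.toBlocks₁₂)ᵀ QU.toBlocks₂₂ =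
        QU + fromBlocks D1 0 0 0 := by
      nth_rewrite 5 [← fromBlocks_toBlocks QU]
      rw [h21, fromBlocks_add, add_comm D1]
      simp only [add_zero]
    have hUQU : U * QU * Uᵀ = Q0 := by
      calc U * QU * Uᵀ = (U * Uᵀ) * Q0 * (U * Uᵀ) := by
            rw [hQU]
            simp only [Matrix.mul_assoc]
        _ = Q0 := by rw [hUr, Matrix.one_mul, Matrix.mul_one]
    rw [hXdef, hblocks, Matrix.mul_add, Matrix.add_mul, hUQU, hU, transpose_fromCols,
      fromCols_mul_fromBlocks, fromCols_mul_fromRows]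
    simp only [Matrix.mul_zero, add_zero, Matrix.zero_mul]
  have hXs : Xᵀ = X := by
    rw [hX]
    simp only [transpose_add, transpose_mul, transpose_transpose, hQ0s, hD1sym, Matrix.mul_assoc]
  have hAt : Atil = Uᵀ * (A0 * V) := by rw [hAtil, hV, Matrix.mul_assoc]
  have hconj {a b : ℕ} (Y : Matrix (Fin n) (Fin a) ℝ) (Z : Matrix (Fin n) (Fin b) ℝ) :
      (Uᵀ * Y)ᵀ * QU * (Uᵀ * Z) = Yᵀ * Q0 * Z := by
    calc (Uᵀ * Y)ᵀ * QU * (Uᵀ * Z) = Yᵀ * (U * Uᵀ) * Q0 * (U * Uᵀ) * Z := by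
          rw [hQU, transpose_mul, transpose_transpose]
          simp only [Matrix.mul_assoc]
      _ = Yᵀ * Q0 * Z := by rw [hUr, Matrix.mul_one, Matrix.mul_one]
  have hB1V : B1 = Vᵀ * B := by
    rw [hB1, hBU, hV]
    rfl
  have hA1V : A1 = Vᵀ * (A0 * V) := by
    rw [hA1, hAt, hV]
    rfl
  have hRX : R1 + B1ᵀ * D1 * B1 = R + Bᵀ * X * B := by
    rw [hR1, hBU, hconj, hB1V, hX, transpose_mul, transpose_transpose]
    simp only [Matrix.mul_add, Matrix.add_mul, Matrix.mul_assoc, add_assoc]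
  have hSX : A1ᵀ * D1 * B1 + S1 = Vᵀ * (A0ᵀ * X * B) := by
    rw [hS1, hAt, hBU, hconj, hB1V, hA1V, hX]
    simp only [transpose_mul, transpose_transpose, Matrix.mul_add, Matrix.add_mul,
      Matrix.mul_assoc]
    abel
  have hSXt : B1ᵀ * D1 * A1 + S1ᵀ = (A0ᵀ * X * B)ᵀ * V := by
    have := congrArg Matrix.transpose hSX
    simpa only [transpose_add, transpose_mul, transpose_transpose, hD1sym, Matrix.mul_assoc]
      using this
  have hQX : A1ᵀ * D1 * A1 + Q1 = Vᵀ * (A0ᵀ * X * A0) * V := by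
    rw [hQ1, hAt, hconj, hA1V, hX]
    simp only [transpose_mul, transpose_transpose, Matrix.mul_add, Matrix.add_mul,
      Matrix.mul_assoc]
    abel
  rw [hRX] at hRD1d hker1
  have hd : RD1d = RXd := hRD1d.unique hRXd
  rw [add_comm S1, hSX] at hker1
  rw [hSX, hSXt, hd] at heq1
  have hVD : V * D1 * Vᵀ =
      A0ᵀ * X * A0 - (A0ᵀ * X * B) * RXd * (A0ᵀ * X * B)ᵀ := by
    have hD : D1 = Vᵀ * (A0ᵀ * X * A0) * V
        - Vᵀ * (A0ᵀ * X * B) * RXd * ((A0ᵀ * X * B)ᵀ * V) := by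
      rw [← hQX]
      refine heq1.trans ?_
      abel
    have hBXA : (A0ᵀ * X * B)ᵀ = Bᵀ * X * A0 := by
      simp only [transpose_mul, transpose_transpose, hXs, Matrix.mul_assoc]
    rw [hBXA] at hD ⊢
    calc V * D1 * Vᵀ = (V * (Vᵀ * A0ᵀ)) * X * (A0 * V * Vᵀ)
          - ((V * (Vᵀ * A0ᵀ)) * X * B) * RXd * (Bᵀ * X * (A0 * V * Vᵀ)) := by
          rw [hD]
          simp only [Matrix.mul_sub, Matrix.sub_mul, Matrix.mul_assoc]
      _ = _ := by rw [hVA0, hA0V]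
  refine ⟨hXs, riccati_of_feedback (A0 := A0) (R := R) (F := Rd * Sᵀ) ?_ ?_ hR hXs rfl hRXd ?_ ?_⟩
  · rw [hA0, Matrix.mul_assoc, sub_add_cancel]
  · rw [transpose_mul, transpose_transpose, hRds, hSR]
  · intro v hv
    have h := hker1 hv
    rw [LinearMap.mem_ker, mulVecLin_apply] at h ⊢
    have h' := congrArg (V *ᵥ ·) h
    simp only [mulVec_mulVec, mulVec_zero] at h'
    rwa [← Matrix.mul_assoc, ← Matrix.mul_assoc, ← Matrix.mul_assoc, Matrix.mul_assoc V, hVA0]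
      at h'
  · rw [← hVD, ← Matrix.mul_assoc S, ← hQ0, add_comm]
    exact hX
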